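/- arXiv:1802.09651 — 9 statements merged into one kernel-verified Lean document; each statement's English description precedes it below -/
import Mathlib

section
/- Let G=(V,E) be a directed graph, let r≥2 be an integer, and let I⊆V. Then the initial set I percolates via bootstrap percolation with threshold r on G if and only if G is strongly r-robust with respect to I. -/
/-- The in-neighborhood of node `i` in the directed graph with edge relation `E`
(`E j i` means there is an edge from `j` to `i`). -/
def inNbr {V : Type*} (E : V → V → Prop) (i : V) : Set V := {j | E j i}

/-- A set `C` is `r`-reachable if some node in `C` has at least `r` in-neighbors outside `C`. -/
def RReachable {V : Type*} (E : V → V → Prop) (r : ℕ) (C : Set V) : Prop :=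
  ∃ i ∈ C, r ≤ (inNbr E i \ C).ncard

/-- `G` is strongly `r`-robust w.r.t. `S` if every nonempty subset of `V ∖ S` is `r`-reachable. -/
def StronglyRobust {V : Type*} (E : V → V → Prop) (r : ℕ) (S : Set V) : Prop :=
  ∀ C : Set V, C ⊆ Set.univ \ S → C.Nonempty → RReachable E r C

/-- The bootstrap percolation process on `G` with threshold `r` and initial active set `I`:
`A_0 = I` and `A_{t+1} = A_t ∪ {v | |N_v ∩ A_t| ≥ r}`. -/
def bootIter {V : Type*} (E : V → V → Prop) (r : ℕ) (I : Set V) : ℕ → Set V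
  | 0 => I
  | t + 1 => bootIter E r I t ∪ {v | r ≤ (inNbr E v ∩ bootIter E r I t).ncard}

theorem monotone_bootIter {V : Type*} (E : V → V → Prop) (r : ℕ) (I : Set V) :
    Monotone (bootIter E r I) :=
  monotone_nat_of_le_succ fun _ => Set.subset_union_left

/-- A set that avoids the initial set and is not `r`-reachable is never entered. -/
theorem disjoint_bootIter_of_not_rReachable {V : Type*} [Finite V] {E : V → V → Prop} {r : ℕ}
    {I C : Set V} (hC : Disjoint I C) (hr : ¬ RReachable E r C) (t : ℕ) :
    Disjoint (bootIter E r I t) C := by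
  induction t with
  | zero => exact hC
  | succ t ih =>
    refine Set.disjoint_union_left.2 ⟨ih, Set.disjoint_left.2 fun v hv hvC => hr ⟨v, hvC, ?_⟩⟩
    refine le_trans hv (Set.ncard_le_ncard ?_ (Set.toFinite _))
    exact fun j hj => ⟨hj.1, Set.disjoint_left.1 ih hj.2⟩

/-- On a finite vertex set, the percolation process reaches its union in finitely many steps. -/
theorem exists_bootIter_eq_iUnion {V : Type*} [Finite V] (E : V → V → Prop) (r : ℕ) (I : Set V) :
    ∃ T, bootIter E r I T = ⋃ t, bootIter E r I t := by
  obtain ⟨T, hT⟩ := WellFoundedGT.monotone_chain_condition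
    (⟨bootIter E r I, monotone_bootIter E r I⟩ : ℕ →o Set V)
  refine ⟨T, (Set.subset_iUnion _ T).antisymm (Set.iUnion_subset fun t => ?_)⟩
  exact (monotone_bootIter E r I (le_max_right T t)).trans (hT _ (le_max_left T t)).ge

/-- For a threshold `r ≥ 2`, the initial set `I` percolates via bootstrap percolation
(`⋃_{t ≥ 0} A_t = V`) if and only if `G` is strongly `r`-robust w.r.t. `I`. -/
theorem percolates_iff_strongly_robust {V : Type*} [Fintype V] (E : V → V → Prop)
    (r : ℕ) (hr : 2 ≤ r) (I : Set V) :
    (⋃ t : ℕ, bootIter E r I t) = Set.univ ↔ StronglyRobust E r I := by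
  constructor
  · intro h C hC ⟨v, hv⟩
    by_contra hn
    obtain ⟨t, ht⟩ := Set.mem_iUnion.1 (h ▸ Set.mem_univ v)
    have hIC : Disjoint I C := Set.disjoint_right.2 fun x hx => (hC hx).2
    exact Set.disjoint_left.1 (disjoint_bootIter_of_not_rReachable hIC hn t) ht hv
  · intro h
    obtain ⟨T, hT⟩ := exists_bootIter_eq_iUnion E r I
    rw [← hT]
    by_contra hne
    have hI : I ⊆ bootIter E r I T := monotone_bootIter E r I (Nat.zero_le T)
    obtain ⟨i, hi, hir⟩ := h (bootIter E r I T)ᶜ (fun x hx => ⟨trivial, fun hxI => hx (hI hxI)⟩)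
      (Set.nonempty_compl.2 hne)
    rw [Set.sdiff_compl] at hir
    have hmem : i ∈ bootIter E r I (T + 1) := Or.inr hir
    exact hi (hT ▸ Set.mem_iUnion_of_mem (T + 1) hmem)
end

section
/- Let G=(V,E) be a directed graph, f∈ℕ, S⊆V, and suppose G is strongly (3f+1)-robust with respect to S. Let A⊆V be any f-local set. Consider the monotone activation process B_0 = S∖A, B_{t+1} = B_t ∪ {v∈V∖A : |N_v∩B_t| ≥ 2f+1}. Then ⋃_{t≥0} B_t = V∖A, i.e., every node outside A eventually becomes active. -/
/-- A set `C` is `f`-local if every node outside `C` has at most `f` in-neighbors in `C`. -/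
def FLocal {V : Type*} (E : V → V → Prop) (f : ℕ) (C : Set V) : Prop :=
  ∀ i ∉ C, (inNbr E i ∩ C).ncard ≤ f

/-- The monotone activation process with adversarial set `A`:
`B_0 = S ∖ A` and `B_{t+1} = B_t ∪ {v ∈ V ∖ A | |N_v ∩ B_t| ≥ 2f+1}`. -/
def actIter {V : Type*} (E : V → V → Prop) (f : ℕ) (S A : Set V) : ℕ → Set V
  | 0 => S \ A
  | t + 1 => actIter E f S A t ∪ {v | v ∉ A ∧ 2 * f + 1 ≤ (inNbr E v ∩ actIter E f S A t).ncard}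

theorem monotone_actIter {V : Type*} (E : V → V → Prop) (f : ℕ) (S A : Set V) :
    Monotone (actIter E f S A) :=
  monotone_nat_of_le_succ fun _ => Set.subset_union_left

theorem actIter_subset_compl {V : Type*} (E : V → V → Prop) (f : ℕ) (S A : Set V) (t : ℕ) :
    actIter E f S A t ⊆ Aᶜ := by
  induction t with
  | zero => exact fun v hv => hv.2
  | succ t ih => exact Set.union_subset ih fun v hv => hv.1

/-- If `G` is strongly `(3f+1)`-robust w.r.t. `S` and `A` is any `f`-local set, then in the
activation process `B_0 = S ∖ A`, `B_{t+1} = B_t ∪ {v ∈ V ∖ A : |N_v ∩ B_t| ≥ 2f+1}`,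
every node outside `A` eventually becomes active: `⋃_{t ≥ 0} B_t = V ∖ A`. -/
theorem activation_covers_regular_nodes {V : Type*} [Fintype V] (E : V → V → Prop)
    (f : ℕ) (S A : Set V)
    (hrob : StronglyRobust E (3 * f + 1) S) (hA : FLocal E f A) :
    (⋃ t : ℕ, actIter E f S A t) = Set.univ \ A := by
  obtain ⟨T, hT⟩ := WellFoundedGT.monotone_chain_condition
    ⟨actIter E f S A, monotone_actIter E f S A⟩
  replace hT : ∀ m, T ≤ m → actIter E f S A T = actIter E f S A m := hT
  refine Set.Subset.antisymm
    (Set.iUnion_subset fun t v hv => ⟨trivial, actIter_subset_compl E f S A t hv⟩) ?_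
  rintro v ⟨-, hvA⟩
  refine Set.mem_iUnion.2 ⟨T, ?_⟩
  by_contra hvT
  obtain ⟨i, ⟨hiA, hiT⟩, hi⟩ := hrob (Aᶜ \ actIter E f S A T)
    (fun w hw => ⟨trivial, fun hwS =>
      hw.2 (monotone_actIter E f S A (Nat.zero_le T) ⟨hwS, hw.1⟩)⟩) ⟨v, hvA, hvT⟩
  have hsplit : inNbr E i \ (Aᶜ \ actIter E f S A T) =
      (inNbr E i ∩ A) ∪ (inNbr E i ∩ actIter E f S A T) := by
    ext w
    simp only [Set.mem_sdiff, Set.mem_union, Set.mem_inter_iff, Set.mem_compl_iff]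
    tauto
  have hcard := Set.ncard_union_le (inNbr E i ∩ A) (inNbr E i ∩ actIter E f S A T)
  have hlocal := hA i hiA
  rw [hsplit] at hi
  apply hiT
  rw [hT (T + 1) (Nat.le_succ T)]
  exact Or.inr ⟨hiA, by omega⟩
end

section
/- Let G=(V,E) be a directed graph that is strongly r-robust with respect to a set S⊆V, for an integer r≥1. Let G'=(V∪{v_new}, E∪E_new) be obtained from G by adding a new node v_new together with a set E_new of edges incident to v_new, such that v_new has at least r in-neighbors in V, i.e., |{j∈V : (j,v_new)∈E_new}| ≥ r. Then G' is strongly r-robust with respect to S. -/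
/-- The edge relation of the graph `G' = (V ∪ {v_new}, E ∪ E_new)` obtained from `G = (V, E)`
by adding a new node `v_new` (modeled as `none : Option V`) together with a set of edges
incident to `v_new`: edges into `v_new` from the nodes in `newIn`, and edges out of `v_new`
to the nodes in `newOut`. -/
def addNodeE {V : Type*} (E : V → V → Prop) (newIn newOut : Set V) :
    Option V → Option V → Prop
  | some j, some i => E j i
  | some j, none => j ∈ newIn
  | none, some i => i ∈ newOut
  | none, none => False

/-- In-neighbors of an old node outside the trace of `C` on the old nodes remain in-neighbors
outside `C` after adding a node. -/
lemma image_some_inNbr_diff_subset {V : Type*} (E : V → V → Prop) (newIn newOut : Set V)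
    (C : Set (Option V)) (i : V) :
    some '' (inNbr E i \ some ⁻¹' C) ⊆ inNbr (addNodeE E newIn newOut) (some i) \ C := by
  rintro _ ⟨j, ⟨hj, hjC⟩, rfl⟩
  exact ⟨hj, hjC⟩

/-- If `G` is strongly `r`-robust w.r.t. `S` and a new node `v_new` is added with at least `r`
in-neighbors among the existing nodes, then the resulting graph `G'` is strongly `r`-robust
w.r.t. `S`. -/
theorem strongly_robust_add_node {V : Type*} [Fintype V] (E : V → V → Prop)
    (r : ℕ) (hr : 1 ≤ r) (S : Set V) (h : StronglyRobust E r S)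
    (newIn newOut : Set V) (hIn : r ≤ newIn.ncard) :
    StronglyRobust (addNodeE E newIn newOut) r (some '' S) := by
  intro C hC hne
  by_cases hD : (some ⁻¹' C).Nonempty
  · obtain ⟨i, hi, hcard⟩ := h (some ⁻¹' C)
      (fun x hx => ⟨trivial, fun hxS => (hC hx).2 ⟨x, hxS, rfl⟩⟩) hD
    refine ⟨some i, hi, hcard.trans ?_⟩
    rw [← Set.ncard_image_of_injective _ (Option.some_injective V)]
    exact Set.ncard_le_ncard (image_some_inNbr_diff_subset E newIn newOut C i) (Set.toFinite _)
  · have hsome (x : V) : some x ∉ C := fun hx => hD ⟨x, hx⟩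
    have hnone : none ∈ C := by
      obtain ⟨_ | x, hx⟩ := hne
      · exact hx
      · exact absurd hx (hsome x)
    refine ⟨none, hnone, hIn.trans ?_⟩
    rw [← Set.ncard_image_of_injective newIn (Option.some_injective V)]
    refine Set.ncard_le_ncard ?_ (Set.toFinite _)
    rintro _ ⟨j, hj, rfl⟩
    exact ⟨hj, hsome j⟩
end

section
/- Let G=(V,E) be a directed graph that is strongly r-robust with respect to a set S⊆V, and let D⊆V be a k-local set with 0 < k < r. Then the induced subgraph of G on V∖D is strongly (r−k)-robust with respect to S∖D. -/
/-- If `G` is strongly `r`-robust w.r.t. `S` and `D` is a `k`-local set with `0 < k < r`,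
then the induced subgraph on `V ∖ D` (modeled on the subtype `{v // v ∉ D}`) is strongly
`(r - k)`-robust w.r.t. `S ∖ D`. -/
theorem strongly_robust_remove_local {V : Type*} [Fintype V] (E : V → V → Prop)
    (r k : ℕ) (S D : Set V) (h : StronglyRobust E r S)
    (hk0 : 0 < k) (hkr : k < r) (hD : FLocal E k D) :
    StronglyRobust (fun a b : {v : V // v ∉ D} => E a.1 b.1) (r - k)
      {x : {v : V // v ∉ D} | (x : V) ∈ S} := by
  intro C hC hne
  obtain ⟨_, ⟨i, hi, rfl⟩, hr⟩ := h (Subtype.val '' C)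
    (by rintro _ ⟨x, hx, rfl⟩; exact ⟨trivial, (hC hx).2⟩) (hne.image _)
  refine ⟨i, hi, ?_⟩
  set N : Set {v : V // v ∉ D} := inNbr (fun a b => E a.1 b.1) i \ C
  have hsub : inNbr E i.1 \ Subtype.val '' C ⊆ Subtype.val '' N ∪ (inNbr E i.1 ∩ D) := by
    rintro j ⟨hj, hjC⟩
    by_cases hjD : j ∈ D
    · exact Or.inr ⟨hj, hjD⟩
    · exact Or.inl ⟨⟨j, hjD⟩, ⟨hj, fun hc => hjC ⟨_, hc, rfl⟩⟩, rfl⟩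
  have hcard := (Set.ncard_le_ncard hsub (Set.toFinite _)).trans (Set.ncard_union_le _ _)
  rw [Set.ncard_image_of_injective N Subtype.val_injective] at hcard
  have hlocal := hD i.1 i.2
  omega
end

section
/- Let G=(V,E) be a directed graph that is strongly r-robust with respect to a set S⊆V, with V∖S nonempty, and let D⊊V be a k-local set with k < r. Then S is not contained in D. -/
/-- If `G` is strongly `r`-robust w.r.t. `S` with `V ∖ S` nonempty, and `D ⊊ V` is a `k`-local
set with `k < r`, then `S` is not contained in `D`. -/
theorem source_not_in_local_set {V : Type*} [Fintype V] (E : V → V → Prop)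
    (r k : ℕ) (S D : Set V) (h : StronglyRobust E r S)
    (hne : (Set.univ \ S).Nonempty) (hD : FLocal E k D)
    (hDproper : D ⊂ Set.univ) (hk : k < r) : ¬ S ⊆ D := by
  intro hSD
  obtain ⟨x, hx⟩ : Dᶜ.Nonempty := Set.nonempty_compl.mpr hDproper.ne
  obtain ⟨i, hi, hri⟩ := h Dᶜ (fun y hy => ⟨Set.mem_univ y, fun hyS => hy (hSD hyS)⟩) ⟨x, hx⟩
  rw [Set.sdiff_compl] at hri
  exact absurd (hri.trans (hD i hi)) (not_le.mpr hk)
end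

section
/- Let G=(V,E) be a directed graph, S⊆V, and f∈ℕ. If G contains a spanning subgraph G_S that is a MEDAG with respect to (S,f), then G is strongly (2f+1)-robust with respect to S. -/
/-- A spanning subgraph of `G = (V, E)` with edge relation `ES` is a Mode Estimation Directed
Acyclic Graph (MEDAG) w.r.t. `(S, f)` if for every `f`-local set `A` (with `R = V ∖ A`):
(i) every regular non-source node `i ∈ (V ∖ S) ∩ R` has at least `2f+1` in-neighbors in the
subgraph; and (ii) `R` can be partitioned into levels `L_0, …, L_T` (`T ≥ 1`) with
`L_0 = S ∩ R`, nodes in `L_0` having no in-neighbors in the subgraph, and every regular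
in-neighbor of a node of level `q ≥ 1` lying in levels `0, …, q-1`. -/
def IsMEDAG {V : Type*} (E ES : V → V → Prop) (S : Set V) (f : ℕ) : Prop :=
  (∀ a b, ES a b → E a b) ∧
  ∀ A : Set V, FLocal E f A →
    ((∀ i, i ∉ S → i ∉ A → 2 * f + 1 ≤ (inNbr ES i).ncard) ∧
      ∃ T : ℕ, 0 < T ∧ ∃ L : ℕ → Set V,
        (∀ q q', q ≤ T → q' ≤ T → q ≠ q' → Disjoint (L q) (L q')) ∧
        (⋃ q ∈ Finset.range (T + 1), L q) = Aᶜ ∧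
        L 0 = S ∩ Aᶜ ∧
        (∀ i ∈ L 0, inNbr ES i = ∅) ∧
        (∀ q, 1 ≤ q → q ≤ T → ∀ i ∈ L q, inNbr ES i ∩ Aᶜ ⊆ ⋃ p ∈ Finset.range q, L p))

/-- If `G` contains a spanning subgraph that is a MEDAG w.r.t. `(S, f)`, then `G` is
strongly `(2f+1)`-robust w.r.t. `S`. -/
theorem medag_implies_strongly_robust {V : Type*} [Fintype V] (E : V → V → Prop)
    (S : Set V) (f : ℕ) (h : ∃ ES : V → V → Prop, IsMEDAG E ES S f) :
    StronglyRobust E (2 * f + 1) S := by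
  obtain ⟨ES, hsub, hA⟩ := h
  intro C hC hne
  obtain ⟨hdeg, T, -, L, -, hcover, hL0, -, hlow⟩ := hA ∅ (by intro i _; simp)
  have hlevel : ∃ q, q ≤ T ∧ (L q ∩ C).Nonempty := by
    obtain ⟨c, hc⟩ := hne
    have hmem : c ∈ ⋃ q ∈ Finset.range (T + 1), L q := by rw [hcover]; simp
    simp only [Set.mem_iUnion, Finset.mem_range] at hmem
    obtain ⟨q, hq, hcq⟩ := hmem
    exact ⟨q, by omega, c, hcq, hc⟩
  classical
  obtain ⟨hqT, i, hiL, hiC⟩ := Nat.find_spec hlevel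
  have hmin := fun p => Nat.find_min hlevel (m := p)
  generalize Nat.find hlevel = q at hqT hiL hmin
  have hiS : i ∉ S := (hC hiC).2
  have hq : 1 ≤ q := by
    rcases Nat.eq_zero_or_pos q with rfl | hpos
    · rw [hL0] at hiL
      exact absurd hiL.1 hiS
    · exact hpos
  refine ⟨i, hiC, (hdeg i hiS (by simp)).trans (Set.ncard_le_ncard ?_ (Set.toFinite _))⟩
  intro j hj
  refine ⟨hsub j i hj, fun hjC => ?_⟩
  have hjlow := hlow q hq hqT i hiL ⟨hj, by simp⟩
  simp only [Set.mem_iUnion, Finset.mem_range] at hjlow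
  obtain ⟨p, hp, hjp⟩ := hjlow
  exact hmin p hp ⟨by omega, j, hjp, hjC⟩
end

section
/- Let G=(V,E) be a directed graph, S⊆V, and f∈ℕ. If G is strongly (2f+1)-robust with respect to S, then G contains a spanning subgraph G_S that is a MEDAG with respect to (S,f). -/
/-- Strong robustness yields a rank function vanishing exactly on `S`, for which every node outside
`S` has at least `r` in-neighbors of smaller rank. -/
theorem StronglyRobust.exists_rank {V : Type*} [Finite V] {E : V → V → Prop} {r : ℕ} {S : Set V}
    (h : StronglyRobust E r S) :
    ∃ rk : V → ℕ, (∀ i, rk i = 0 ↔ i ∈ S) ∧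
      ∀ i ∉ S, r ≤ (inNbr E i ∩ {j | rk j < rk i}).ncard := by
  classical
  let P : Set V → Prop := fun B ↦ S ⊆ B ∧ ∃ rk : V → ℕ, (∀ i, rk i = 0 ↔ i ∈ S) ∧
    ∀ i ∈ B, i ∉ S → r ≤ (inNbr E i ∩ {j | j ∈ B ∧ rk j < rk i}).ncard
  have hS : P S := by
    refine ⟨subset_rfl, fun i ↦ if i ∈ S then 0 else 1, fun i ↦ ?_, fun i hi hi' ↦ (hi' hi).elim⟩
    by_cases hi : i ∈ S <;> simp [hi]
  obtain ⟨B, ⟨hSB, rk, hrk, hB⟩, hmax⟩ := (Set.toFinite {B | P B}).exists_maximal ⟨S, hS⟩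
  have hBuniv : ∀ i, i ∈ B := by
    by_contra! hne
    obtain ⟨i, hiC, hi⟩ := h Bᶜ (fun x hx ↦ ⟨trivial, fun hxS ↦ hx (hSB hxS)⟩) hne
    obtain ⟨M, hM⟩ := (Set.finite_range rk).bddAbove
    have hM' : ∀ j, rk j ≤ M := fun j ↦ hM ⟨j, rfl⟩
    have hP : P (insert i B) := by
      refine ⟨hSB.trans (Set.subset_insert i B), Function.update rk i (M + 1), fun k ↦ ?_,
        fun k hk hkS ↦ ?_⟩
      · rcases eq_or_ne k i with rfl | hki
        · simpa using fun hkS ↦ hiC (hSB hkS)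
        · simp [hki, hrk]
      · rcases eq_or_ne k i with rfl | hki
        · refine hi.trans (Set.ncard_le_ncard ?_ (Set.toFinite _))
          rintro j ⟨hj, hjB⟩
          have hjB : j ∈ B := not_not.mp hjB
          have hjk : j ≠ k := fun e ↦ hiC (e ▸ hjB)
          exact ⟨hj, Or.inr hjB, by simpa [hjk] using Nat.lt_succ_of_le (hM' j)⟩
        · have hkB : k ∈ B := hk.resolve_left hki
          refine (hB k hkB hkS).trans (Set.ncard_le_ncard ?_ (Set.toFinite _))
          rintro j ⟨hj, hjB, hlt⟩
          have hji : j ≠ i := fun e ↦ hiC (e ▸ hjB)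
          exact ⟨hj, Or.inr hjB, by simpa [hji, hki] using hlt⟩
    exact hiC (hmax hP (Set.subset_insert i B) (Set.mem_insert i B))
  refine ⟨rk, hrk, fun i hi ↦ ?_⟩
  simpa [hBuniv] using hB i (hBuniv i) hi

/-- If `G` is strongly `(2f+1)`-robust w.r.t. `S`, then `G` contains a spanning subgraph
that is a MEDAG w.r.t. `(S, f)`. -/
theorem strongly_robust_implies_medag {V : Type*} [Fintype V] (E : V → V → Prop)
    (S : Set V) (f : ℕ) (h : StronglyRobust E (2 * f + 1) S) :
    ∃ ES : V → V → Prop, IsMEDAG E ES S f := by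
  obtain ⟨rk, hrk, hcard⟩ := h.exists_rank
  obtain ⟨M, hM⟩ := (Set.finite_range rk).bddAbove
  have hM' : ∀ j, rk j ≤ M := fun j ↦ hM ⟨j, rfl⟩
  refine ⟨fun j i ↦ E j i ∧ rk j < rk i, fun _ _ hab ↦ hab.1, fun A _ ↦
    ⟨fun i hi _ ↦ hcard i hi, M + 1, M.succ_pos, fun q ↦ {i | rk i = q ∧ i ∉ A},
      ?_, ?_, ?_, ?_, ?_⟩⟩
  · intro q q' _ _ hne
    exact Set.disjoint_left.mpr fun i hi hi' ↦ hne (hi.1.symm.trans hi'.1)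
  · ext i
    have := hM' i
    simp only [Set.mem_iUnion, Finset.mem_range, Set.mem_ofPred_eq, Set.mem_compl_iff]
    exact ⟨fun ⟨_, _, _, hi⟩ ↦ hi, fun hi ↦ ⟨rk i, by omega, rfl, hi⟩⟩
  · ext i
    simp [hrk]
  · rintro i ⟨hi, -⟩
    ext j
    simp [inNbr, hi]
  · rintro q - - i ⟨rfl, -⟩ j ⟨⟨-, hlt⟩, hjA⟩
    simp only [Set.mem_iUnion, Finset.mem_range]
    exact ⟨rk j, hlt, rfl, hjA⟩
end

section
/- Let N be a finite index set with |N| ≥ 2f+1 for some f∈ℕ, let x : N → ℝ, and let R⊆N with |N∖R| ≤ f (the indices in N∖R are 'adversarial'). Let U,J⊆N be disjoint sets with |U|=|J|=f such that x_u ≥ x_m for all u∈U and all m∈M, and x_j ≤ x_m for all j∈J and all m∈M, where M = N∖(U∪J) (i.e., U and J consist of f largest and f smallest values, respectively). Then R is nonempty and every m∈M satisfies min_{u∈R} x_u ≤ x_m ≤ max_{u∈R} x_u; in particular, every convex combination of the values {x_m : m∈M} lies between the minimum and maximum of the values of x over R. -/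
/-- A subset of `N` with more elements than `N \ R` meets `R`. -/
theorem Finset.exists_mem_of_card_sdiff_lt {ι : Type*} [DecidableEq ι] {N R T : Finset ι}
    (hT : T ⊆ N) (hcard : (N \ R).card < T.card) : ∃ t ∈ T, t ∈ R := by
  by_contra! h
  exact hcard.not_ge (Finset.card_le_card fun t ht => Finset.mem_sdiff.2 ⟨hT ht, h t ht⟩)

/-- If `S ⊆ N` has at least `|N \ R|` elements and `m ∈ N` lies outside `S`, then `R` contains
`m` or an element of `S`. -/
theorem Finset.exists_mem_insert_of_card_sdiff_le {ι : Type*} [DecidableEq ι] {N R S : Finset ι}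
    {m : ι} (hS : S ⊆ N) (hm : m ∈ N) (hmS : m ∉ S) (hcard : (N \ R).card ≤ S.card) :
    ∃ t ∈ insert m S, t ∈ R :=
  Finset.exists_mem_of_card_sdiff_lt (Finset.insert_subset hm hS)
    (by rw [Finset.card_insert_of_notMem hmS]; exact Nat.lt_succ_of_le hcard)


/-- Trimming lemma: let `N` be a finite index set with `|N| ≥ 2f+1`, `x : N → ℝ` a collection
of values, and `R ⊆ N` the regular indices with at most `f` adversarial indices (`|N∖R| ≤ f`).
If `U` and `J` are disjoint `f`-element subsets of `N` consisting of (some) `f` largest and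
`f` smallest values respectively, and `M = N ∖ (U ∪ J)`, then `R` is nonempty, every value
`x m`, `m ∈ M`, lies between the minimum and maximum of `x` over `R`, and consequently so
does every convex combination of the values `{x m : m ∈ M}`. -/
theorem trimmed_values_between_regular_extremes {ι : Type*} [DecidableEq ι]
    (N : Finset ι) (f : ℕ) (hN : 2 * f + 1 ≤ N.card)
    (x : ι → ℝ) (R : Finset ι) (hRN : R ⊆ N) (hadv : (N \ R).card ≤ f)
    (U J : Finset ι) (hUN : U ⊆ N) (hJN : J ⊆ N) (hUJ : Disjoint U J)
    (hUcard : U.card = f) (hJcard : J.card = f)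
    (hUx : ∀ u ∈ U, ∀ m ∈ N \ (U ∪ J), x m ≤ x u)
    (hJx : ∀ j ∈ J, ∀ m ∈ N \ (U ∪ J), x j ≤ x m) :
    ∃ hR : R.Nonempty,
      (∀ m ∈ N \ (U ∪ J), R.inf' hR x ≤ x m ∧ x m ≤ R.sup' hR x) ∧
      ∀ w : ι → ℝ, (∀ m ∈ N \ (U ∪ J), 0 ≤ w m) → (∑ m ∈ N \ (U ∪ J), w m) = 1 →
        R.inf' hR x ≤ (∑ m ∈ N \ (U ∪ J), w m * x m) ∧
        (∑ m ∈ N \ (U ∪ J), w m * x m) ≤ R.sup' hR x := by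
  have hR : R.Nonempty := by
    obtain ⟨t, -, ht⟩ := Finset.exists_mem_of_card_sdiff_lt (R := R) (Finset.Subset.refl N)
      (by omega)
    exact ⟨t, ht⟩
  have hmem : ∀ m ∈ N \ (U ∪ J), x m ∈ Set.Icc (R.inf' hR x) (R.sup' hR x) := by
    intro m hm
    obtain ⟨hmN, hmUJ⟩ := Finset.mem_sdiff.1 hm
    rw [Finset.mem_union, not_or] at hmUJ
    constructor
    · obtain ⟨t, ht, htR⟩ :=
        Finset.exists_mem_insert_of_card_sdiff_le hJN hmN hmUJ.2 (hadv.trans hJcard.ge)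
      refine (Finset.inf'_le x htR).trans ?_
      rcases Finset.mem_insert.1 ht with rfl | htJ
      exacts [le_rfl, hJx t htJ m hm]
    · obtain ⟨t, ht, htR⟩ :=
        Finset.exists_mem_insert_of_card_sdiff_le hUN hmN hmUJ.1 (hadv.trans hUcard.ge)
      refine le_trans ?_ (Finset.le_sup' x htR)
      rcases Finset.mem_insert.1 ht with rfl | htU
      exacts [le_rfl, hUx t htU m hm]
  exact ⟨hR, hmem, fun w hw hsum => (convex_Icc _ _).sum_mem hw hsum hmem⟩
end

section
/- Let G=(V,E) be a directed graph, S⊆V, f∈ℕ, and let G_S=(V,E_S) be a MEDAG with respect to (S,f). Let A⊆V be an f-local set, R=V∖A, and let L_0,…,L_T be a partition of R as guaranteed by the MEDAG definition for this A. Let M∈ℝ^{d×d}, and let z[k+1]=Mz[k], k∈ℕ, be a trajectory in ℝ^d. Suppose every node l∈V produces a sequence ẑ_l[k]∈ℝ^d (the sequences of nodes in A being completely arbitrary) such that: (a) for every i∈L_0, ẑ_i[k]−z[k]→0 as k→∞; and (b) for every i∈R∖L_0, every k∈ℕ, and every component m∈{1,…,d}, there exist disjoint subsets U_i^m[k],J_i^m[k]⊆N_i^S,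 each of cardinality f, with ẑ_u^{(m)}[k] ≥ ẑ_l^{(m)}[k] ≥ ẑ_j^{(m)}[k] for all u∈U_i^m[k], l∈M_i^m[k]:=N_i^S∖(U_i^m[k]∪J_i^m[k]), j∈J_i^m[k], and nonnegative weights w_{il}^m[k], l∈M_i^m[k], summing to 1, such that ẑ_i[k+1] = M z̄_i[k], where the m-th component of z̄_i[k] equals Σ_{l∈M_i^m[k]} w_{il}^m[k] ẑ_l^{(m)}[k]. Then ẑ_i[k]−z[k]→0 as k→∞ for every i∈R. -/
open Filter

/-- If at most `f` elements of `N` lie in `A` and `l ∈ N ∩ A`, then any `f`-element subset of `N`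
avoiding `l` contains an element outside `A`. -/
lemma exists_mem_notMem_of_ncard_inter_le {V : Type*} [Finite V] {N A U : Set V} {f : ℕ} {l : V}
    (hNA : (N ∩ A).ncard ≤ f) (hU : U ⊆ N) (hUf : U.ncard = f) (hlN : l ∈ N) (hlA : l ∈ A)
    (hlU : l ∉ U) : ∃ u ∈ U, u ∉ A := by
  by_contra! h
  have hsub : insert l U ⊆ N ∩ A :=
    Set.insert_subset ⟨hlN, hlA⟩ fun u hu => ⟨hU hu, h u hu⟩
  have hcard := Set.ncard_le_ncard hsub (Set.toFinite _)
  rw [Set.ncard_insert_of_notMem hlU (Set.toFinite _)] at hcard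
  omega

/-- A convex combination of values within `B` of `c` is within `B` of `c`. -/
lemma abs_sum_mul_sub_le {ι : Type*} {s : Finset ι} {w x : ι → ℝ} {c B : ℝ}
    (hw : ∀ l ∈ s, 0 ≤ w l) (hw1 : ∑ l ∈ s, w l = 1) (hx : ∀ l ∈ s, |x l - c| ≤ B) :
    |∑ l ∈ s, w l * x l - c| ≤ B := by
  have hmem : ∑ l ∈ s, w l • x l ∈ Metric.closedBall c B :=
    (convex_closedBall c B).sum_mem hw hw1 fun l hl => by
      simpa [Metric.mem_closedBall, Real.dist_eq] using hx l hl
  simpa [Metric.mem_closedBall, Real.dist_eq] using hmem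

/-- After trimming the `f` largest and `f` smallest values over `N`, each remaining value is
within `B` of `c`, provided all values at elements of `N` outside `A` are, and `N` has at most `f`
elements in `A`. -/
lemma abs_sub_le_of_trimmed {V : Type*} [Finite V] {N A U J : Set V} {f : ℕ} {x : V → ℝ}
    {c B : ℝ} (hNA : (N ∩ A).ncard ≤ f) (hU : U ⊆ N) (hJ : J ⊆ N)
    (hUf : U.ncard = f) (hJf : J.ncard = f)
    (hUx : ∀ u ∈ U, ∀ l ∈ N \ (U ∪ J), x l ≤ x u)
    (hJx : ∀ j ∈ J, ∀ l ∈ N \ (U ∪ J), x j ≤ x l)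
    (hx : ∀ l ∈ N, l ∉ A → |x l - c| ≤ B) {l : V} (hl : l ∈ N \ (U ∪ J)) :
    |x l - c| ≤ B := by
  by_cases hlA : l ∈ A
  · obtain ⟨u, hu, huA⟩ := exists_mem_notMem_of_ncard_inter_le hNA hU hUf hl.1 hlA
      fun h => hl.2 (Or.inl h)
    obtain ⟨j, hj, hjA⟩ := exists_mem_notMem_of_ncard_inter_le hNA hJ hJf hl.1 hlA
      fun h => hl.2 (Or.inr h)
    have hxu := abs_le.1 (hx u (hU hu) huA)
    have hxj := abs_le.1 (hx j (hJ hj) hjA)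
    have hlu := hUx u hu l hl
    have hjl := hJx j hj l hl
    exact abs_le.2 ⟨by linarith, by linarith⟩
  · exact hx l hl.1 hlA

/-- Convergence of the local-filtering based resilient estimation (LFRE) dynamics on a MEDAG.
Let `G_S = (V, E_S)` be a MEDAG w.r.t. `(S, f)`, `A` an `f`-local adversarial set with
regular nodes `R = V ∖ A`, and `L_0, …, L_T` a partition of `R` as guaranteed by the MEDAG
definition for this `A`.  Let `z[k+1] = M z[k]` be a trajectory in `ℝ^d`, and suppose each
node `l` produces a sequence `ẑ_l[k]` (those of nodes in `A` arbitrary) such that every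
regular node in `L_0` has `ẑ_i[k] − z[k] → 0`, and every regular node outside `L_0` updates
via the trimmed-consensus rule: for each component `m`, after discarding disjoint sets of
`f` largest and `f` smallest estimates among its MEDAG in-neighbors, it forms a convex
combination of the remaining estimates and applies `M`.  Then `ẑ_i[k] − z[k] → 0` for every
regular node `i`. -/
theorem lfre_convergence {V : Type*} [Fintype V] (E ES : V → V → Prop) (S : Set V) (f : ℕ)
    (hMEDAG : IsMEDAG E ES S f)
    (A : Set V) (hA : FLocal E f A)
    (T : ℕ) (hT : 0 < T) (L : ℕ → Set V)
    (hLdisj : ∀ q q', q ≤ T → q' ≤ T → q ≠ q' → Disjoint (L q) (L q'))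
    (hLcover : (⋃ q ∈ Finset.range (T + 1), L q) = Aᶜ)
    (hL0 : L 0 = S ∩ Aᶜ)
    (hL0nbr : ∀ i ∈ L 0, inNbr ES i = ∅)
    (hLlevel : ∀ q, 1 ≤ q → q ≤ T → ∀ i ∈ L q, inNbr ES i ∩ Aᶜ ⊆ ⋃ p ∈ Finset.range q, L p)
    (d : ℕ) (M : Matrix (Fin d) (Fin d) ℝ)
    (z : ℕ → Fin d → ℝ) (hz : ∀ k : ℕ, z (k + 1) = M.mulVec (z k))
    (zhat : V → ℕ → Fin d → ℝ)
    (ha : ∀ i ∈ L 0, Tendsto (fun k => zhat i k - z k) atTop (nhds 0))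
    (hb : ∀ i ∈ Aᶜ, i ∉ L 0 → ∀ k : ℕ,
      ∃ zbar : Fin d → ℝ, zhat i (k + 1) = M.mulVec zbar ∧
        ∀ m : Fin d, ∃ (U J : Set V) (w : V → ℝ),
          U ⊆ inNbr ES i ∧ J ⊆ inNbr ES i ∧ Disjoint U J ∧
          U.ncard = f ∧ J.ncard = f ∧
          (∀ u ∈ U, ∀ l ∈ inNbr ES i \ (U ∪ J), zhat l k m ≤ zhat u k m) ∧
          (∀ j ∈ J, ∀ l ∈ inNbr ES i \ (U ∪ J), zhat j k m ≤ zhat l k m) ∧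
          (∀ l ∈ inNbr ES i \ (U ∪ J), 0 ≤ w l) ∧
          (∑ l ∈ (Set.toFinite (inNbr ES i \ (U ∪ J))).toFinset, w l) = 1 ∧
          zbar m = ∑ l ∈ (Set.toFinite (inNbr ES i \ (U ∪ J))).toFinset, w l * zhat l k m) :
    ∀ i ∈ Aᶜ, Tendsto (fun k => zhat i k - z k) atTop (nhds 0) := by
  have hlevel : ∀ q ≤ T, ∀ i ∈ L q, Tendsto (fun k => zhat i k - z k) atTop (nhds 0) := by
    intro q
    induction q using Nat.strong_induction_on with
    | _ q ih =>
      intro hqT i hi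
      rcases Nat.eq_zero_or_pos q with rfl | hq
      · exact ha i hi
      have hiA : i ∈ Aᶜ := by
        rw [← hLcover]
        exact Set.mem_biUnion (Finset.mem_coe.2 (Finset.mem_range.2 (Nat.lt_succ_of_le hqT))) hi
      have hi0 : i ∉ L 0 := fun h =>
        Set.disjoint_left.1 (hLdisj 0 q (Nat.zero_le _) hqT hq.ne) h hi
      have hNA : (inNbr ES i ∩ A).ncard ≤ f :=
        (Set.ncard_le_ncard (Set.inter_subset_inter_left _ fun j hj => hMEDAG.1 j i hj)
          (Set.toFinite _)).trans (hA i hiA)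
      have hreg : ∀ l ∈ inNbr ES i, l ∉ A →
          Tendsto (fun k => zhat l k - z k) atTop (nhds 0) := by
        intro l hl hlA
        obtain ⟨p, hp, hlp⟩ := Set.mem_iUnion₂.1 (hLlevel q hq hqT i hi ⟨hl, hlA⟩)
        have hpq := Finset.mem_range.1 hp
        exact ih p hpq (hpq.le.trans hqT) l hlp
      choose zbar hzbar htrim using hb i hiA hi0
      have hbar : Tendsto (fun k => zbar k - z k) atTop (nhds 0) := by
        rw [tendsto_pi_nhds]
        intro m
        have hB : Tendsto (fun k => ∑ l ∈ (Set.toFinite (inNbr ES i \ A)).toFinset,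
            |zhat l k m - z k m|) atTop (nhds 0) := by
          rw [← Finset.sum_const_zero (s := (Set.toFinite (inNbr ES i \ A)).toFinset)]
          refine tendsto_finsetSum _ fun l hl => ?_
          rw [Set.Finite.mem_toFinset] at hl
          simpa using ((tendsto_pi_nhds.1 (hreg l hl.1 hl.2)) m).abs
        refine squeeze_zero_norm (fun k => ?_) hB
        obtain ⟨U, J, w, hU, hJ, -, hUf, hJf, hUx, hJx, hw, hw1, hsum⟩ := htrim k m
        rw [Pi.sub_apply, Real.norm_eq_abs, hsum]
        refine abs_sum_mul_sub_le (fun l hl => hw l ((Set.Finite.mem_toFinset _).1 hl)) hw1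
          fun l hl => ?_
        refine abs_sub_le_of_trimmed (x := fun l => zhat l k m) hNA hU hJ hUf hJf hUx hJx
          (fun j hj hjA => ?_) ((Set.Finite.mem_toFinset _).1 hl)
        exact Finset.single_le_sum (f := fun j => |zhat j k m - z k m|)
          (fun _ _ => abs_nonneg _) ((Set.Finite.mem_toFinset _).2 ⟨hj, hjA⟩)
      rw [← tendsto_add_atTop_iff_nat 1]
      have hcont : Continuous fun v : Fin d → ℝ => M.mulVec v :=
        continuous_const.matrix_mulVec continuous_id
      have hlim := (hcont.tendsto 0).comp hbar
      rw [Matrix.mulVec_zero] at hlim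
      refine hlim.congr fun k => ?_
      rw [Function.comp_apply, Matrix.mulVec_sub, hzbar, hz]
  intro i hi
  rw [← hLcover] at hi
  obtain ⟨q, hq, hiq⟩ := Set.mem_iUnion₂.1 hi
  exact hlevel q (Nat.lt_succ_iff.1 (Finset.mem_range.1 hq)) i hiq
end
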